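/- Let z(t) = 1 + δ·ξ(t) on [0, π/2] with δ < 0, where ξ(t) = (cos²t + 2t·sin t·cos t + t² − π²/4)/cos²t (extended by ξ(π/2) = 0). Then z satisfies (1/2)z''(t)·cos²t − z'(t)·cos t·sin t − z(t) = −1 + 2δ·cos²t on (0, π/2), z'(t)·sin t ≤ 0 on [0, π/2], and z(t) ≥ z(π/2) = 1 for all t in [0, π/2]. -/

import Mathlib

open Real Set

noncomputable def xi (t : ℝ) : ℝ :=
  (Real.cos t ^ 2 + 2 * t * Real.sin t * Real.cos t + t ^ 2 - Real.pi ^ 2 / 4) / Real.cos t ^ 2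

/-- The numerator of `xi`. -/
noncomputable def xiNum (t : ℝ) : ℝ :=
  Real.cos t ^ 2 + 2 * t * Real.sin t * Real.cos t + t ^ 2 - Real.pi ^ 2 / 4

lemma hasDerivAt_xiNum (t : ℝ) : HasDerivAt xiNum (4 * t * Real.cos t ^ 2) t := by
  have h := (((((Real.hasDerivAt_cos t).pow 2).add ((((hasDerivAt_id t).const_mul 2).mul
    (Real.hasDerivAt_sin t)).mul (Real.hasDerivAt_cos t))).add
    ((hasDerivAt_id t).pow 2)).sub_const (Real.pi ^ 2 / 4))
  refine h.congr_deriv ?_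
  simp only [id, Nat.cast_ofNat, Pi.mul_apply]
  linear_combination (-2 * t) * Real.sin_sq_add_cos_sq t

lemma xiNum_pi_div_two : xiNum (Real.pi / 2) = 0 := by
  simp only [xiNum, Real.cos_pi_div_two]
  ring

lemma xiNum_nonpos {t : ℝ} (ht : t ∈ Icc (0 : ℝ) (Real.pi / 2)) : xiNum t ≤ 0 := by
  have hmono : MonotoneOn xiNum (Icc (0 : ℝ) (Real.pi / 2)) := by
    refine monotoneOn_of_hasDerivWithinAt_nonneg (convex_Icc _ _)
      (fun x _ => (hasDerivAt_xiNum x).continuousAt.continuousWithinAt)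
      (fun x _ => (hasDerivAt_xiNum x).hasDerivWithinAt) fun x hx => ?_
    rw [interior_Icc] at hx
    have := hx.1
    positivity
  rw [← xiNum_pi_div_two]
  exact hmono ht ⟨by positivity, le_rfl⟩ ht.2

lemma xi_nonpos {t : ℝ} (ht : t ∈ Icc (0 : ℝ) (Real.pi / 2)) : xi t ≤ 0 :=
  div_nonpos_of_nonpos_of_nonneg (xiNum_nonpos ht) (sq_nonneg _)

lemma xi_pi_div_two : xi (Real.pi / 2) = 0 := by
  simp [xi]

lemma hasDerivAt_xi {t : ℝ} (ht : Real.cos t ≠ 0) :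
    HasDerivAt xi (4 * t + 2 * xiNum t * Real.sin t / Real.cos t ^ 3) t := by
  have h := (hasDerivAt_xiNum t).div ((Real.hasDerivAt_cos t).pow 2) (pow_ne_zero 2 ht)
  refine HasDerivAt.congr_deriv (f := xi) h ?_
  simp only [Nat.cast_ofNat, Pi.pow_apply]
  field_simp
  ring

lemma hasDerivAt_deriv_xi {t : ℝ} (ht : Real.cos t ≠ 0) :
    HasDerivAt (deriv xi) (4 + 8 * t * Real.sin t / Real.cos t +
      2 * xiNum t * (Real.cos t ^ 2 + 3 * Real.sin t ^ 2) / Real.cos t ^ 4) t := by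
  have heq : deriv xi =ᶠ[nhds t]
      fun x => 4 * x + 2 * xiNum x * Real.sin x / Real.cos x ^ 3 := by
    filter_upwards [Real.continuous_cos.continuousAt.eventually_ne ht] with x hx
    exact (hasDerivAt_xi hx).deriv
  have h := ((hasDerivAt_id t).const_mul 4).add
    ((((hasDerivAt_xiNum t).const_mul 2).mul (Real.hasDerivAt_sin t)).div
      ((Real.hasDerivAt_cos t).pow 3) (pow_ne_zero 3 ht))
  refine HasDerivAt.congr_of_eventuallyEq (h.congr_deriv ?_) heq
  simp only [Nat.cast_ofNat, Pi.pow_apply, Pi.mul_apply]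
  field_simp
  ring

lemma xiNum_add_nonneg {t : ℝ} (ht : t ∈ Ioo (0 : ℝ) (Real.pi / 2)) :
    0 ≤ xiNum t + 2 * t * Real.cos t ^ 3 / Real.sin t := by
  have hs : ∀ x ∈ Icc t (Real.pi / 2), 0 < Real.sin x := fun x hx =>
    Real.sin_pos_of_pos_of_lt_pi (ht.1.trans_le hx.1) (by linarith [hx.2, Real.pi_pos])
  have hd : ∀ x ∈ Icc t (Real.pi / 2),
      HasDerivAt (fun x => xiNum x + 2 * x * Real.cos x ^ 3 / Real.sin x)
        (2 * Real.cos x ^ 2 / Real.sin x ^ 2 * (Real.sin x * Real.cos x - x)) x := by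
    intro x hx
    have h0 := (hs x hx).ne'
    have h := (hasDerivAt_xiNum x).add ((((hasDerivAt_id x).const_mul 2).mul
      ((Real.hasDerivAt_cos x).pow 3)).div (Real.hasDerivAt_sin x) h0)
    refine h.congr_deriv ?_
    simp only [id, Nat.cast_ofNat, Pi.pow_apply, Pi.mul_apply]
    field_simp
    linear_combination (-2 * x * Real.cos x ^ 2) * Real.sin_sq_add_cos_sq x
  have hanti : AntitoneOn (fun x => xiNum x + 2 * x * Real.cos x ^ 3 / Real.sin x)
      (Icc t (Real.pi / 2)) := by
    refine antitoneOn_of_hasDerivWithinAt_nonpos (convex_Icc _ _)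
      (fun x hx => (hd x hx).continuousAt.continuousWithinAt)
      (fun x hx => (hd x (interior_subset hx)).hasDerivWithinAt) fun x hx => ?_
    have hx := interior_subset hx
    have h1 := (Real.sin_lt (ht.1.trans_le hx.1)).le
    have h2 := mul_le_of_le_one_right (hs x hx).le (Real.cos_le_one x)
    exact mul_nonpos_of_nonneg_of_nonpos (by positivity) (by linarith)
  have h := hanti ⟨le_rfl, ht.2.le⟩ ⟨ht.2.le, le_rfl⟩ ht.2.le
  simpa [xiNum_pi_div_two] using h

lemma deriv_xi_nonneg {t : ℝ} (ht : t ∈ Ioo (0 : ℝ) (Real.pi / 2)) : 0 ≤ deriv xi t := by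
  have hc : 0 < Real.cos t := Real.cos_pos_of_mem_Ioo ⟨by linarith [ht.1, Real.pi_pos], ht.2⟩
  have hs : 0 < Real.sin t :=
    Real.sin_pos_of_pos_of_lt_pi ht.1 (by linarith [ht.2, Real.pi_pos])
  have h := xiNum_add_nonneg ht
  rw [(hasDerivAt_xi hc.ne').deriv]
  have heq : 4 * t + 2 * xiNum t * Real.sin t / Real.cos t ^ 3 =
      2 * Real.sin t / Real.cos t ^ 3 * (xiNum t + 2 * t * Real.cos t ^ 3 / Real.sin t) := by
    field_simp
    ring
  rw [heq]
  positivity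

lemma deriv_xi_pi_div_two_nonneg : 0 ≤ deriv xi (Real.pi / 2) := by
  by_cases hdiff : DifferentiableAt ℝ xi (Real.pi / 2)
  · have h := hdiff.hasDerivAt.hasDerivWithinAt (s := Iio (Real.pi / 2))
    rw [hasDerivWithinAt_iff_tendsto_slope' self_notMem_Iio] at h
    refine ge_of_tendsto h ?_
    filter_upwards [Ioo_mem_nhdsLT (show (0 : ℝ) < Real.pi / 2 by positivity)] with x hx
    rw [slope_def_field, xi_pi_div_two, sub_zero]
    exact div_nonneg_of_nonpos (xi_nonpos ⟨hx.1.le, hx.2.le⟩) (by linarith [hx.2])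
  · rw [deriv_zero_of_not_differentiableAt hdiff]

theorem z_properties (δ : ℝ) (hδ : δ < 0) :
    let z : ℝ → ℝ := fun t => 1 + δ * xi t
    (∀ t ∈ Ioo (0:ℝ) (Real.pi / 2),
      (1 / 2) * deriv (deriv z) t * Real.cos t ^ 2
        - deriv z t * Real.cos t * Real.sin t - z t = -1 + 2 * δ * Real.cos t ^ 2) ∧
    (∀ t ∈ Icc (0:ℝ) (Real.pi / 2), deriv z t * Real.sin t ≤ 0) ∧
    (∀ t ∈ Icc (0:ℝ) (Real.pi / 2), z t ≥ z (Real.pi / 2)) ∧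
    z (Real.pi / 2) = 1 := by
  intro z
  have hz : deriv z = fun t => δ * deriv xi t := by
    funext t
    rw [deriv_const_add, deriv_const_mul_field]
  have hz1 : z (Real.pi / 2) = 1 := by simp [z, xi_pi_div_two]
  refine ⟨fun t ht => ?_, fun t ht => ?_, fun t ht => ?_, hz1⟩
  · have hc : Real.cos t ≠ 0 :=
      (Real.cos_pos_of_mem_Ioo ⟨by linarith [ht.1, Real.pi_pos], ht.2⟩).ne'
    have hxi : xi t = xiNum t / Real.cos t ^ 2 := rfl
    rw [hz, deriv_const_mul_field, (hasDerivAt_deriv_xi hc).deriv]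
    simp only [z]
    rw [(hasDerivAt_xi hc).deriv, hxi]
    field_simp
    linear_combination (2 * δ * xiNum t) * Real.sin_sq_add_cos_sq t
  · have hs : 0 ≤ Real.sin t :=
      Real.sin_nonneg_of_nonneg_of_le_pi ht.1 (by linarith [ht.2, Real.pi_pos])
    rcases ht.1.eq_or_lt with rfl | h0
    · simp
    have hd : 0 ≤ deriv xi t := by
      rcases ht.2.eq_or_lt with rfl | h1
      · exact deriv_xi_pi_div_two_nonneg
      · exact deriv_xi_nonneg ⟨h0, h1⟩
    rw [hz]
    exact mul_nonpos_of_nonpos_of_nonneg (mul_nonpos_of_nonpos_of_nonneg hδ.le hd) hs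
  · rw [hz1]
    have := mul_nonneg_of_nonpos_of_nonpos hδ.le (xi_nonpos ht)
    simp only [z]
    linarith
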